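/- arXiv:2210.02233 — 2 statements merged into one kernel-verified Lean document; each statement's English description precedes it below -/
import Mathlib

section
/- Let S ⊆ ℕ be a good set and let α be an irrational real number. Then the limit measure μ_{S,α} is a continuous (atomless) measure: μ_{S,α}({γ}) = 0 for every point γ of the torus 𝕋. -/
open MeasureTheory Filter Topology
open scoped BigOperators

noncomputable section

open Classical in
/-- `S(N) = S ∩ {1,…,N}` as a `Finset`. -/
def initSeg (S : Set ℕ) (N : ℕ) : Finset ℕ := (Finset.Icc 1 N).filter (· ∈ S)

/-- The average `(1/#S(N)) ∑_{s ∈ S(N)} f (sα mod 1)`. -/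
def empAvg (S : Set ℕ) (α : ℝ) (N : ℕ) (f : UnitAddCircle → ℝ) : ℝ :=
  ((initSeg S N).card : ℝ)⁻¹ * ∑ s ∈ initSeg S N, f (((s : ℝ) * α : ℝ) : UnitAddCircle)

/-- `μ` is the weak limit of the empirical measures `(1/#S(N)) ∑_{s ∈ S(N)} δ_{sα mod 1}`. -/
def IsLimitMeasure (S : Set ℕ) (α : ℝ) (μ : Measure UnitAddCircle) : Prop :=
  ∀ f : C(UnitAddCircle, ℝ),
    Tendsto (fun N => empAvg S α N (fun x => f x)) atTop (𝓝 (∫ x, f x ∂μ))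

/-- A good set: infinite, and for every `α` the empirical measures converge weakly
to some (probability) limit measure `μ_{S,α}`. -/
def IsGoodSet (S : Set ℕ) : Prop :=
  S.Infinite ∧ ∀ α : ℝ, ∃ μ : Measure UnitAddCircle, IsProbabilityMeasure μ ∧ IsLimitMeasure S α μ

/-- `R` is sublacunary: `log N / #R(N) → 0`. -/
def Sublacunary (R : Set ℕ) : Prop :=
  Tendsto (fun N : ℕ => Real.log N / ((initSeg R N).card : ℝ)) atTop (𝓝 0)

open Classical in
/-- `#{n < N : r_n ∈ S}` where `(r_n)` is the increasing (0-indexed) enumeration of `R`. -/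
def relCount (R S : Set ℕ) (N : ℕ) : ℕ :=
  ((Finset.range N).filter (fun n => Nat.nth (· ∈ R) n ∈ S)).card

/-- Weighted average `(1/∑_{n<N} w n) ∑_{n<N} w n · f (r_n β mod 1)`. -/
def wAvg (R : Set ℕ) (w : ℕ → ℝ) (β : ℝ) (N : ℕ) (f : UnitAddCircle → ℝ) : ℝ :=
  (∑ n ∈ Finset.range N, w n)⁻¹ *
    ∑ n ∈ Finset.range N, w n * f (((Nat.nth (· ∈ R) n : ℝ) * β : ℝ) : UnitAddCircle)

/-- `μ` is the weak limit of the `w`-weighted empirical measures along `R` at `β`. -/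
def IsWeightLimit (R : Set ℕ) (w : ℕ → ℝ) (β : ℝ) (μ : Measure UnitAddCircle) : Prop :=
  ∀ f : C(UnitAddCircle, ℝ),
    Tendsto (fun N => wAvg R w β N (fun x => f x)) atTop (𝓝 (∫ x, f x ∂μ))

/-- A good weight on `R` (indexed by the increasing enumeration of `R`). -/
def IsGoodWeight (R : Set ℕ) (w : ℕ → ℝ) : Prop :=
  (∀ n, 0 ≤ w n) ∧ ¬ Summable w ∧
    ∀ β : ℝ, ∃ μ : Measure UnitAddCircle, IsProbabilityMeasure μ ∧ IsWeightLimit R w β μ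

/-- Besicovitch-type seminorm `‖f‖₁ = limsup_N (1/N) ∑_{n<N} |f n|`. -/
def besic (f : ℕ → ℝ) : ℝ := Filter.limsup (fun N => (∑ n ∈ Finset.range N, |f n|) / N) atTop

/-- An integrable weight: approximable in `‖·‖₁` by bounded good weights. -/
def IntegrableWeight (R : Set ℕ) (w : ℕ → ℝ) : Prop :=
  ∀ ε > 0, ∃ v : ℕ → ℝ, IsGoodWeight R v ∧ (∃ C, ∀ n, v n ≤ C) ∧
    besic (fun n => v n - w n) < ε

/-- Total variation distance between two finite Borel measures on the torus. -/
def varDist (μ ν : Measure UnitAddCircle) : ℝ :=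
  ⨆ B : Set UnitAddCircle, ⨆ _ : MeasurableSet B, |(μ B).toReal - (ν B).toReal|

/-- `e(θ) = exp(2πiθ)`. -/
def eC (θ : ℝ) : ℂ := Complex.exp (2 * Real.pi * Complex.I * θ)

/-- `w(R(N)) = ∑_{r ∈ R(N)} w r`. -/
def wSum (R : Set ℕ) (w : ℕ → ℝ) (N : ℕ) : ℝ := ∑ r ∈ initSeg R N, w r

/-- `μ` is the weak limit of `(1/w(R(N))) ∑_{r ∈ R(N)} w r · δ_{rβ mod 1}`. -/
def IsWeightLimitR (R : Set ℕ) (w : ℕ → ℝ) (β : ℝ) (μ : Measure UnitAddCircle) : Prop :=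
  ∀ f : C(UnitAddCircle, ℝ),
    Tendsto
      (fun N => (wSum R w N)⁻¹ * ∑ r ∈ initSeg R N, w r * f (((r : ℝ) * β : ℝ) : UnitAddCircle))
      atTop (𝓝 (∫ x, f x ∂μ))

/-- `f : ℕ → ℂ` has mean `c`. -/
def HasMean (f : ℕ → ℂ) (c : ℂ) : Prop :=
  Tendsto (fun N => (∑ n ∈ Finset.range N, f n) / (N : ℂ)) atTop (𝓝 c)

/-- The seminorm `‖f‖_M = limsup_N |(1/N) ∑_{n<N} f n|`. -/
def meanSeminorm (f : ℕ → ℂ) : ℝ :=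
  Filter.limsup (fun N => ‖(∑ n ∈ Finset.range N, f n) / (N : ℂ)‖) atTop

end

open AddCircle in
/-- The squared `L²` norm of a trigonometric polynomial with coefficients bounded by `C / #s`
is at most `C² / #s`. -/
lemma integral_norm_sq_average_fourier_le (s : Finset ℕ) (u : ℕ → ℂ) (C : ℝ)
    (hu : ∀ n, ‖u n‖ ≤ C) :
    ∫ x : UnitAddCircle, ‖(s.card : ℂ)⁻¹ * ∑ n ∈ s, u n * fourier n x‖ ^ 2 ∂haarAddCircle
      ≤ C ^ 2 * (s.card : ℝ)⁻¹ := by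
  set c : ℕ → ℂ := fun n => (s.card : ℂ)⁻¹ * u n with hc
  set B : C(UnitAddCircle, ℂ) := ∑ n ∈ s, c n • fourier (n : ℤ) with hB
  have hBx : ∀ x, B x = (s.card : ℂ)⁻¹ * ∑ n ∈ s, u n * fourier n x := by
    intro x
    simp only [hB, hc, ContinuousMap.coe_sum, Finset.sum_apply, ContinuousMap.coe_smul,
      Pi.smul_apply, smul_eq_mul, Finset.mul_sum, mul_assoc]
  have horth : Orthonormal ℂ (fun n : ℕ => fourierLp (T := 1) 2 (n : ℤ)) :=
    orthonormal_fourier.comp _ Nat.cast_injective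
  have hL : ContinuousMap.toLp (E := ℂ) 2 haarAddCircle ℂ B
      = ∑ n ∈ s, c n • fourierLp (T := 1) 2 (n : ℤ) := by
    rw [hB, map_sum]
    exact Finset.sum_congr rfl fun n _ => map_smul _ _ _
  have h1 := ContinuousMap.inner_toLp (𝕜 := ℂ) (haarAddCircle (T := 1)) B B
  rw [hL, horth.inner_sum] at h1
  have h2 : ((∫ x, ‖B x‖ ^ 2 ∂haarAddCircle : ℝ) : ℂ) = ((∑ n ∈ s, ‖c n‖ ^ 2 : ℝ) : ℂ) := by
    rw [← integral_complex_ofReal]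
    push_cast
    simp only [← Complex.mul_conj']
    rw [← h1]
    exact Finset.sum_congr rfl fun n _ => mul_comm _ _
  rw [Complex.ofReal_inj] at h2
  simp only [← hBx, h2]
  calc ∑ n ∈ s, ‖c n‖ ^ 2 ≤ ∑ n ∈ s, ((s.card : ℝ)⁻¹ * C) ^ 2 := by
        refine Finset.sum_le_sum fun n _ => ?_
        simp only [hc, norm_mul, norm_inv, Complex.norm_natCast]
        gcongr
        exact hu n
    _ = C ^ 2 * (s.card : ℝ)⁻¹ := by
        rw [Finset.sum_const, nsmul_eq_mul]
        rcases eq_or_ne (s.card : ℝ) 0 with h | h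
        · simp [h]
        · field_simp

/-- If continuous functions converge pointwise and tend to zero in `L²`, their limits cannot be
bounded away from zero on a dense set. -/
lemma not_forall_dense_le_norm_limit {X : Type*} [TopologicalSpace X] [CompactSpace X] [T2Space X]
    [Nonempty X] [MeasurableSpace X] [BorelSpace X] (ν : Measure X) [IsFiniteMeasure ν]
    [ν.IsOpenPosMeasure] (B : ℕ → X → ℂ) (hcont : ∀ N, Continuous (B N))
    (hconv : ∀ x, ∃ L, Tendsto (fun N => B N x) atTop (𝓝 L))
    (hL2 : Tendsto (fun N => ∫ x, ‖B N x‖ ^ 2 ∂ν) atTop (𝓝 0))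
    (Z : Set X) (hZ : Dense Z) (c : ℝ) (hc : 0 < c) :
    ¬ ∀ z ∈ Z, ∃ L, c ≤ ‖L‖ ∧ Tendsto (fun N => B N z) atTop (𝓝 L) := by
  intro hlim
  let F : ℕ → Set X := fun n => {x | ∀ M ≥ n, ∀ N ≥ n, dist (B M x) (B N x) ≤ c / 4}
  have hFc : ∀ n, IsClosed (F n) := fun n => by
    simp only [F, Set.ofPred_forall]
    exact isClosed_iInter fun M => isClosed_iInter fun _ => isClosed_iInter fun N =>
      isClosed_iInter fun _ => isClosed_le ((hcont M).dist (hcont N)) continuous_const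
  have hFu : ⋃ n, F n = Set.univ := by
    refine Set.eq_univ_of_forall fun x => Set.mem_iUnion.2 ?_
    obtain ⟨L, hL⟩ := hconv x
    obtain ⟨n, hn⟩ := Metric.cauchySeq_iff.1 hL.cauchySeq (c / 4) (by positivity)
    exact ⟨n, fun M hM N hN => (hn M hM N hN).le⟩
  obtain ⟨n, hn⟩ := nonempty_interior_of_iUnion_of_closed hFc hFu
  set V := interior (F n) with hV
  have hVo : IsOpen V := isOpen_interior
  have hbig : ∀ N ≥ n, ∀ x ∈ V, c / 2 ≤ ‖B N x‖ := by
    intro N hN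
    have hcl : IsClosed {x | c / 2 ≤ ‖B N x‖} := isClosed_le continuous_const (hcont N).norm
    have hsub : V ∩ Z ⊆ {x | c / 2 ≤ ‖B N x‖} := by
      rintro z ⟨hzV, hzZ⟩
      obtain ⟨L, hcL, hL⟩ := hlim z hzZ
      have hd : dist L (B N z) ≤ c / 4 := by
        refine le_of_tendsto (hL.dist tendsto_const_nhds) ?_
        filter_upwards [eventually_ge_atTop n] with M hM
        exact interior_subset hzV M hM N hN
      rw [dist_eq_norm] at hd
      have := norm_sub_norm_le L (B N z)
      change c / 2 ≤ ‖B N z‖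
      linarith
    exact (hZ.open_subset_closure_inter hVo).trans (closure_minimal hsub hcl)
  have hVpos : 0 < ν.real V := by
    rw [Measure.real, ENNReal.toReal_pos_iff]
    exact ⟨hVo.measure_pos ν hn, measure_lt_top _ _⟩
  have hlow : ∀ N ≥ n, (c / 2) ^ 2 * ν.real V ≤ ∫ x, ‖B N x‖ ^ 2 ∂ν := by
    intro N hN
    have hint : Integrable (fun x => ‖B N x‖ ^ 2) ν :=
      ((hcont N).norm.pow 2).integrable_of_hasCompactSupport (HasCompactSupport.of_compactSpace _)
    calc (c / 2) ^ 2 * ν.real V ≤ ∫ x in V, ‖B N x‖ ^ 2 ∂ν := by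
          refine setIntegral_ge_of_const_le_real hVo.measurableSet (measure_ne_top _ _)
            (fun x hx => ?_) hint.integrableOn
          have := hbig N hN x hx
          gcongr
      _ ≤ ∫ x, ‖B N x‖ ^ 2 ∂ν :=
          setIntegral_le_integral hint (.of_forall fun x => by positivity)
  have := ge_of_tendsto hL2 (eventually_atTop.2 ⟨n, hlow⟩)
  have : 0 < (c / 2) ^ 2 * ν.real V := by positivity
  linarith

lemma tendsto_card_initSeg {S : Set ℕ} (hS : S.Infinite) :
    Tendsto (fun N => (initSeg S N).card) atTop atTop := by
  refine tendsto_atTop.2 fun b => ?_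
  obtain ⟨t, hts, rfl⟩ := (hS.sdiff (Set.finite_singleton 0)).exists_subset_card_eq b
  filter_upwards [eventually_ge_atTop (t.sup id)] with N hN
  refine Finset.card_le_card fun n hn => ?_
  have h1 := hts hn
  have h2 : n ≤ t.sup id := Finset.le_sup (f := id) hn
  simp only [Set.mem_sdiff, Set.mem_singleton_iff] at h1
  simp only [initSeg, Finset.mem_filter, Finset.mem_Icc]
  exact ⟨by omega, h1.1⟩

lemma IsLimitMeasure.isProbabilityMeasure {S : Set ℕ} {α : ℝ} {μ : Measure UnitAddCircle}
    (hμ : IsLimitMeasure S α μ) (hS : S.Infinite) : IsProbabilityMeasure μ := by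
  have h1 := hμ 1
  have h2 : Tendsto (fun N => empAvg S α N (fun x => (1 : C(UnitAddCircle, ℝ)) x)) atTop
      (𝓝 1) := by
    refine tendsto_const_nhds.congr' ?_
    filter_upwards [(tendsto_card_initSeg hS).eventually_gt_atTop 0] with N hN
    have : ((initSeg S N).card : ℝ) ≠ 0 := by positivity
    simp [empAvg, this]
  have h3 := tendsto_nhds_unique h1 h2
  simp only [ContinuousMap.one_apply, integral_const, smul_eq_mul, mul_one] at h3
  exact ⟨(ENNReal.toReal_eq_one_iff _).1 h3⟩

lemma IsLimitMeasure.tendsto_complex {S : Set ℕ} {α : ℝ} {μ : Measure UnitAddCircle}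
    [IsFiniteMeasure μ] (hμ : IsLimitMeasure S α μ) (f : C(UnitAddCircle, ℂ)) :
    Tendsto (fun N => ((initSeg S N).card : ℂ)⁻¹ *
      ∑ s ∈ initSeg S N, f (s • (α : UnitAddCircle))) atTop (𝓝 (∫ x, f x ∂μ)) := by
  have hint : Integrable f μ :=
    f.continuous.integrable_of_hasCompactSupport (HasCompactSupport.of_compactSpace _)
  have hre := hμ ⟨fun x => (f x).re, by fun_prop⟩
  have him := hμ ⟨fun x => (f x).im, by fun_prop⟩
  have h := ((Complex.continuous_ofReal.tendsto _).comp hre).add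
    (((Complex.continuous_ofReal.tendsto _).comp him).mul_const Complex.I)
  have hi : ((∫ x, (f x).re ∂μ : ℝ) : ℂ) + ((∫ x, (f x).im ∂μ : ℝ) : ℂ) * Complex.I
      = ∫ x, f x ∂μ := integral_re_add_im hint
  simp only [ContinuousMap.coe_mk] at h
  rw [hi] at h
  refine h.congr fun N => ?_
  have hs : ∀ s : ℕ, (((s : ℝ) * α : ℝ) : UnitAddCircle) = s • (α : UnitAddCircle) := fun s => by
    rw [← AddCircle.coe_nsmul, nsmul_eq_mul]
  simp only [Function.comp_apply, empAvg, hs]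
  push_cast
  rw [mul_assoc, ← mul_add, Finset.sum_mul, ← Finset.sum_add_distrib]
  simp only [Complex.re_add_im]

/-- Averages of a trigonometric polynomial along `s • a`, twisted by any character, converge. -/
lemma IsGoodSet.exists_tendsto_twisted {S : Set ℕ} (hS : IsGoodSet S) (a x : UnitAddCircle)
    {P : C(UnitAddCircle, ℂ)} (hP : P ∈ Submodule.span ℂ (Set.range (@fourier 1))) :
    ∃ L : ℂ, Tendsto (fun N => ((initSeg S N).card : ℂ)⁻¹ *
      ∑ s ∈ initSeg S N, P (s • a) * fourier s x) atTop (𝓝 L) := by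
  induction hP using Submodule.span_induction with
  | mem P hP =>
    obtain ⟨n, rfl⟩ := hP
    obtain ⟨β, hβ⟩ := QuotientAddGroup.mk_surjective (n • a + x)
    obtain ⟨ν, hν, hνl⟩ := hS.2 β
    refine ⟨_, (hνl.tendsto_complex (fourier 1)).congr fun N => ?_⟩
    congr 1
    refine Finset.sum_congr rfl fun s _ => ?_
    change fourier 1 (s • ((QuotientAddGroup.mk β : UnitAddCircle))) = _
    rw [hβ]
    simp only [fourier_apply, one_smul, smul_add, AddCircle.toCircle_add, Circle.coe_mul,
      natCast_zsmul, smul_comm s n a]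
  | zero => exact ⟨0, by simp⟩
  | add P Q _ _ hP hQ =>
    obtain ⟨L, hL⟩ := hP
    obtain ⟨M, hM⟩ := hQ
    refine ⟨L + M, (hL.add hM).congr fun N => ?_⟩
    simp only [ContinuousMap.add_apply, add_mul, Finset.sum_add_distrib, mul_add]
  | smul c P _ hP =>
    obtain ⟨L, hL⟩ := hP
    refine ⟨c * L, (hL.const_mul c).congr fun N => ?_⟩
    simp only [ContinuousMap.smul_apply, smul_eq_mul, mul_assoc, ← Finset.mul_sum]
    ring

/-- If `μ` has an atom, then some trigonometric polynomial `P` has the Fourier coefficients of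
`P μ` bounded away from zero. -/
lemma exists_span_fourier_le_norm_integral (μ : Measure UnitAddCircle) [IsProbabilityMeasure μ]
    {γ : UnitAddCircle} (hγ : μ {γ} ≠ 0) :
    ∃ P ∈ Submodule.span ℂ (Set.range (@fourier 1)), ∃ c > 0,
      ∀ k : ℤ, c ≤ ‖∫ x, P x * fourier k x ∂μ‖ := by
  set p := μ.real {γ} with hp
  have hp0 : 0 < p := ENNReal.toReal_pos hγ (measure_ne_top _ _)
  obtain ⟨U, hγU, hUo, hU⟩ := Set.exists_isOpen_lt_of_lt (μ := μ) {γ} (ENNReal.ofReal (p + p / 4))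
    ((ENNReal.lt_ofReal_iff_toReal_lt (measure_ne_top _ _)).2 (by
      change p < _
      linarith))
  rw [ENNReal.lt_ofReal_iff_toReal_lt (measure_ne_top _ _)] at hU
  change μ.real U < _ at hU
  obtain ⟨f, hf0, hf1, hf⟩ := exists_continuous_zero_one_of_isClosed hUo.isClosed_compl
    (isClosed_singleton (x := γ)) (Set.disjoint_compl_left_iff_subset.2 hγU)
  let g : C(UnitAddCircle, ℂ) := ⟨fun x => (f x : ℂ), by fun_prop⟩
  have hgmem : g ∈ (Submodule.span ℂ (Set.range (@fourier 1))).topologicalClosure := by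
    rw [span_fourier_closure_eq_top]; trivial
  obtain ⟨P, hP, hPg⟩ := Metric.mem_closure_iff.1 hgmem (p / 4) (by positivity)
  have hint : ∀ h : C(UnitAddCircle, ℂ), Integrable h μ := fun h =>
    h.continuous.integrable_of_hasCompactSupport (HasCompactSupport.of_compactSpace _)
  refine ⟨P, hP, p / 2, by positivity, fun k => ?_⟩
  have hfk : ∀ x : UnitAddCircle, ‖fourier k x‖ = 1 := fun x => Circle.norm_coe _
  have h1 : ‖∫ x, g x * fourier k x ∂μ - ∫ x, P x * fourier k x ∂μ‖ ≤ p / 4 := by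
    have hsub := integral_sub (hint (g * fourier k)) (hint (P * fourier k))
    simp only [ContinuousMap.mul_apply] at hsub
    rw [← hsub]
    refine (norm_integral_le_of_norm_le_const (C := p / 4) (.of_forall fun x => ?_)).trans_eq ?_
    · rw [← sub_mul, norm_mul, hfk, mul_one, ← dist_eq_norm]
      exact (ContinuousMap.dist_apply_le_dist x).trans hPg.le
    · simp
  have h2 : ‖∫ x, g x * fourier k x ∂μ - ∫ x in {γ}, g x * fourier k x ∂μ‖ ≤ p / 4 := by
    have hsplit := integral_add_compl (measurableSet_singleton γ) (hint (g * fourier k))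
    simp only [ContinuousMap.mul_apply] at hsplit
    rw [← hsplit, add_sub_cancel_left]
    have hz : ∀ x ∈ ({γ}ᶜ : Set UnitAddCircle) \ (U \ {γ}), g x * fourier k x = 0 := by
      intro x hx
      have hxU : x ∈ Uᶜ := fun h => hx.2 ⟨h, hx.1⟩
      simp [g, hf0 hxU]
    rw [setIntegral_eq_of_subset_of_forall_sdiff_eq_zero (measurableSet_singleton γ).compl
      (fun x hx => hx.2) hz]
    refine (norm_setIntegral_le_of_norm_le_const (C := 1) (measure_lt_top _ _)
      (fun x _ => ?_)).trans ?_
    · rw [norm_mul, hfk, mul_one]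
      simpa [g, abs_of_nonneg (hf x).1] using (hf x).2
    · rw [one_mul, measureReal_sdiff hγU (measurableSet_singleton γ)]
      linarith
  have h3 : ‖∫ x in {γ}, g x * fourier k x ∂μ‖ = p := by
    rw [integral_singleton, norm_smul, norm_mul, hfk]
    simp [g, hf1 rfl, ← hp, abs_of_pos hp0]
  have h4 := norm_sub_norm_le (∫ x in {γ}, g x * fourier k x ∂μ) (∫ x, g x * fourier k x ∂μ)
  have h5 := norm_sub_norm_le (∫ x, g x * fourier k x ∂μ) (∫ x, P x * fourier k x ∂μ)
  rw [norm_sub_rev] at h4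
  linarith

/-- If `S` is a good set and `α` is irrational, then the limit measure
`μ_{S,α}` is continuous (atomless). -/
theorem goodSet_limitMeasure_continuous (S : Set ℕ) (α : ℝ) (μ : MeasureTheory.Measure UnitAddCircle)
    (hS : IsGoodSet S) (hα : Irrational α) (hμ : IsLimitMeasure S α μ) :
    ∀ γ : UnitAddCircle, μ {γ} = 0 := by
  intro γ
  by_contra hγ
  have := hμ.isProbabilityMeasure hS.1
  obtain ⟨P, hP, c, hc, hPc⟩ := exists_span_fourier_le_norm_integral μ hγ
  refine not_forall_dense_le_norm_limit (AddCircle.haarAddCircle (T := 1))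
    (fun N x => ((initSeg S N).card : ℂ)⁻¹ *
      ∑ s ∈ initSeg S N, P (s • (α : UnitAddCircle)) * fourier s x)
    (fun N => by fun_prop) (fun x => hS.exists_tendsto_twisted _ x hP) ?_
    (Set.range fun k : ℤ => k • (α : UnitAddCircle))
    (AddCircle.denseRange_zsmul_coe_iff.2 (by simpa using hα)) c hc ?_
  · have hcard : Tendsto (fun N => ((initSeg S N).card : ℝ)) atTop atTop :=
      tendsto_natCast_atTop_atTop.comp (tendsto_card_initSeg hS.1)
    refine squeeze_zero (fun N => integral_nonneg fun x => by positivity)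
      (fun N => integral_norm_sq_average_fourier_le _ _ ‖P‖ fun n => P.norm_coe_le_norm _) ?_
    simpa using hcard.inv_tendsto_atTop.const_mul (‖P‖ ^ 2)
  · rintro _ ⟨k, rfl⟩
    refine ⟨_, hPc k, (hμ.tendsto_complex (P * fourier k)).congr fun N => ?_⟩
    congr 1
    refine Finset.sum_congr rfl fun s _ => ?_
    simp only [ContinuousMap.mul_apply, fourier_apply, natCast_zsmul, smul_comm k s]
end

section
/- Let ν be a Borel probability measure on the torus 𝕋 that is absolutely continuous with respect to the Lebesgue probability measure λ, and let α be an irrational real number. Then there exists a good set S ⊆ ℕ with μ_{S,α} = ν. -/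
open MeasureTheory Filter Topology
open scoped BigOperators

/-- A sequence may be defined by prescribing each term as a function of the earlier terms. -/
theorem exists_seq_of_causal (Ψ : ℕ → (ℕ → ℝ) → ℝ)
    (hΨ : ∀ n e e', (∀ m < n, e m = e' m) → Ψ n e = Ψ n e') :
    ∃ ε : ℕ → ℝ, ∀ n, ε n = Ψ n ε := by
  let G : (n : ℕ) → ((m : ℕ) → m < n → ℝ) → ℝ :=
    fun n f => Ψ n (fun m => if h : m < n then f m h else 0)
  refine ⟨WellFounded.fix Nat.lt_wfRel.wf G, fun n => ?_⟩
  rw [WellFounded.fix_eq]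
  exact hΨ n _ _ fun m hm => by simp [hm]

/-- The correlation of `e` with its shift by `h + 1` over the first `n` terms. -/
def shiftCorr (e : ℕ → ℝ) (n h : ℕ) : ℝ := ∑ m ∈ Finset.Ico (h + 1) n, e m * e (m - (h + 1))

theorem shiftCorr_succ (e : ℕ → ℝ) {n h : ℕ} (hn : h < n) :
    shiftCorr e (n + 1) h = shiftCorr e n h + e n * e (n - (h + 1)) :=
  Finset.sum_Ico_succ_top (by omega) _

theorem shiftCorr_self (e : ℕ → ℝ) (n : ℕ) : shiftCorr e (n + 1) n = 0 := by
  simp [shiftCorr]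

theorem shiftCorr_congr {e e' : ℕ → ℝ} {n : ℕ} (h : ℕ) (he : ∀ m < n, e m = e' m) :
    shiftCorr e n h = shiftCorr e' n h := by
  refine Finset.sum_congr rfl fun m hm => ?_
  rw [Finset.mem_Ico] at hm
  rw [he m hm.2, he _ (by omega)]

/-- The derivative of the correlation energy in the direction of the next term. -/
def corrGradient (e : ℕ → ℝ) (n : ℕ) : ℝ :=
  ∑ h ∈ Finset.range n, shiftCorr e n h * e (n - (h + 1))

theorem corrGradient_congr {e e' : ℕ → ℝ} {n : ℕ} (he : ∀ m < n, e m = e' m) :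
    corrGradient e n = corrGradient e' n := by
  refine Finset.sum_congr rfl fun h hh => ?_
  rw [Finset.mem_range] at hh
  rw [shiftCorr_congr h he, he _ (by omega)]

theorem sum_sq_shiftCorr_le (e : ℕ → ℝ) (h1 : ∀ n, |e n| ≤ 1)
    (hg : ∀ n, e n * corrGradient e n ≤ 0) (n : ℕ) :
    ∑ h ∈ Finset.range n, shiftCorr e n h ^ 2 ≤ (n : ℝ) ^ 2 := by
  have hsq : ∀ n, e n ^ 2 ≤ 1 := fun n => (sq_le_one_iff_abs_le_one _).2 (h1 n)
  induction n with
  | zero => simp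
  | succ n ih =>
    rw [Finset.sum_range_succ, shiftCorr_self]
    have h2 : ∀ h ∈ Finset.range n, shiftCorr e (n + 1) h ^ 2 ≤
        shiftCorr e n h ^ 2 + 2 * (e n * (shiftCorr e n h * e (n - (h + 1)))) + 1 := by
      intro h hh
      rw [shiftCorr_succ e (Finset.mem_range.1 hh)]
      have : e n ^ 2 * e (n - (h + 1)) ^ 2 ≤ 1 := mul_le_one₀ (hsq _) (sq_nonneg _) (hsq _)
      nlinarith
    have h3 := Finset.sum_le_sum h2
    rw [Finset.sum_add_distrib, Finset.sum_add_distrib, ← Finset.mul_sum, ← Finset.mul_sum] at h3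
    have h4 := hg n
    unfold corrGradient at h4
    simp only [Finset.sum_const, Finset.card_range, nsmul_eq_mul, mul_one] at h3
    push_cast
    nlinarith

theorem norm_sq_sum_mul_pow (e : ℕ → ℝ) {z : ℂ} (hz : ‖z‖ = 1) (n : ℕ) :
    ‖∑ m ∈ Finset.range n, (e m : ℂ) * z ^ m‖ ^ 2 = ∑ m ∈ Finset.range n, e m ^ 2 +
      2 * (∑ h ∈ Finset.range n, z ^ (h + 1) * (shiftCorr e n h : ℂ)).re := by
  have hz' : z * (starRingEnd ℂ) z = 1 := by
    rw [Complex.mul_conj, Complex.normSq_eq_norm_sq, hz]; simp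
  have hzp : ∀ a b : ℕ, z ^ (a + b) * (starRingEnd ℂ) z ^ b = z ^ a := fun a b => by
    rw [pow_add, mul_assoc, ← mul_pow, hz', one_pow, mul_one]
  induction n with
  | zero => simp
  | succ n ih =>
    have h1 : ∑ h ∈ Finset.range (n + 1), z ^ (h + 1) * (shiftCorr e (n + 1) h : ℂ) =
        ∑ h ∈ Finset.range n, z ^ (h + 1) * (shiftCorr e n h : ℂ) +
        ∑ h ∈ Finset.range n, z ^ (h + 1) * (e n * e (n - (h + 1)) : ℂ) := by
      rw [Finset.sum_range_succ, shiftCorr_self, ← Finset.sum_add_distrib]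
      simp only [Complex.ofReal_zero, mul_zero, add_zero]
      refine Finset.sum_congr rfl fun h hh => ?_
      rw [shiftCorr_succ e (Finset.mem_range.1 hh)]
      push_cast; ring
    have h2 : ∑ h ∈ Finset.range n, z ^ (h + 1) * (e n * e (n - (h + 1)) : ℂ) =
        (e n * z ^ n) * (starRingEnd ℂ) (∑ m ∈ Finset.range n, (e m : ℂ) * z ^ m) := by
      rw [← Finset.sum_range_reflect, map_sum, Finset.mul_sum]
      refine Finset.sum_congr rfl fun m hm => ?_
      rw [Finset.mem_range] at hm
      have e1 : n - 1 - m + 1 = n - m := by omega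
      have e2 : n - (n - m) = m := by omega
      rw [e1, e2, map_mul, map_pow, Complex.conj_ofReal, ← hzp (n - m) m,
        Nat.sub_add_cancel hm.le]
      ring
    rw [h1, h2, Finset.sum_range_succ, Finset.sum_range_succ, Complex.add_re, mul_add, ← add_assoc,
      add_right_comm _ (e n ^ 2), ← ih, ← Complex.normSq_eq_norm_sq, ← Complex.normSq_eq_norm_sq,
      Complex.normSq_add, ← Complex.conj_re (_ * _)]
    have h3 : Complex.normSq ((e n : ℂ) * z ^ n) = e n ^ 2 := by
      rw [Complex.normSq_eq_norm_sq, norm_mul, norm_pow, hz]; simp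
    rw [h3, map_mul (starRingEnd ℂ) (∑ m ∈ _, _), Complex.conj_conj, mul_comm ((starRingEnd ℂ) (∑ m ∈ _, _))]

/-- Any `[0,1]`-valued weight can be rounded to a set of integers so that all exponential sums
are preserved up to `O(N ^ (3/4))`, uniformly in the frequency. -/
theorem exists_set_small_discrepancy (w : ℕ → ℝ) (h0 : ∀ n, 0 ≤ w n) (h1 : ∀ n, w n ≤ 1) :
    ∃ S : Set ℕ, 0 ∉ S ∧ ∀ z : ℂ, ‖z‖ = 1 → ∀ N : ℕ,
      ‖∑ n ∈ Finset.range N, ((S.indicator 1 n - w n : ℝ) : ℂ) * z ^ n‖ ^ 4 ≤ 10 * (N : ℝ) ^ 3 := by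
  classical
  obtain ⟨e, he⟩ := exists_seq_of_causal
    (fun n e => (if corrGradient e n < 0 then 1 else 0) - w n)
    (fun n e e' h => by rw [corrGradient_congr h])
  have heq : ∀ n, ({n | corrGradient e n < 0} : Set ℕ).indicator 1 n - w n = e n := by
    intro n
    rw [he n]
    simp [Set.indicator]
  have hb : ∀ n, |e n| ≤ 1 := by
    intro n
    rw [he n, abs_le]
    have := h0 n; have := h1 n
    split_ifs <;> constructor <;> linarith
  have hg : ∀ n, e n * corrGradient e n ≤ 0 := by
    intro n
    have := h0 n; have := h1 n
    by_cases hc : corrGradient e n < 0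
    · have : e n = 1 - w n := by rw [he n, if_pos hc]
      rw [this]; nlinarith
    · have : e n = 0 - w n := by rw [he n, if_neg hc]
      rw [this]; nlinarith
  refine ⟨{n | corrGradient e n < 0}, by simp [corrGradient], fun z hz N => ?_⟩
  simp_rw [heq]
  set Q := ∑ h ∈ Finset.range N, |shiftCorr e N h|
  have hQ0 : 0 ≤ Q := Finset.sum_nonneg fun _ _ => abs_nonneg _
  have hQ : Q ^ 2 ≤ (N : ℝ) ^ 3 := by
    have := sq_sum_le_card_mul_sum_sq (s := Finset.range N) (f := fun h => |shiftCorr e N h|)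
    simp only [sq_abs, Finset.card_range] at this
    have h2 := sum_sq_shiftCorr_le e hb hg N
    calc Q ^ 2 ≤ _ := this
      _ ≤ N * (N : ℝ) ^ 2 := by gcongr
      _ = _ := by ring
  have h3 : ‖∑ n ∈ Finset.range N, (e n : ℂ) * z ^ n‖ ^ 2 ≤ N + 2 * Q := by
    rw [norm_sq_sum_mul_pow e hz]
    have a1 : ∑ m ∈ Finset.range N, e m ^ 2 ≤ N := by
      calc _ ≤ ∑ m ∈ Finset.range N, (1 : ℝ) :=
            Finset.sum_le_sum fun m _ => (sq_le_one_iff_abs_le_one _).2 (hb m)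
        _ = N := by simp
    have a2 : (∑ h ∈ Finset.range N, z ^ (h + 1) * (shiftCorr e N h : ℂ)).re ≤ Q := by
      refine (Complex.re_le_norm _).trans ((norm_sum_le _ _).trans_eq ?_)
      exact Finset.sum_congr rfl fun h _ => by simp [hz]
    linarith
  have h4 : (N : ℝ) ^ 2 ≤ (N : ℝ) ^ 3 := by
    rcases Nat.eq_zero_or_pos N with rfl | hN
    · simp
    · exact pow_le_pow_right₀ (by exact_mod_cast hN) (by norm_num)
  calc _ = (‖∑ n ∈ Finset.range N, (e n : ℂ) * z ^ n‖ ^ 2) ^ 2 := by ring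
    _ ≤ (N + 2 * Q) ^ 2 := by gcongr
    _ ≤ 10 * (N : ℝ) ^ 3 := by nlinarith [sq_nonneg ((N : ℝ) - 2 * Q)]

/-- The `k`-th Fourier coefficient of a measure on the circle. -/
noncomputable def measureFourierCoeff (ν : Measure UnitAddCircle) (k : ℤ) : ℂ :=
  ∫ y, fourier (-k) y ∂ν

theorem norm_fourier_apply (k : ℤ) (x : UnitAddCircle) : ‖fourier k x‖ = 1 := Circle.norm_coe _

theorem fourier_nsmul (k : ℤ) (n : ℕ) (x : UnitAddCircle) :
    fourier k (n • x) = fourier k x ^ n := by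
  rw [fourier_apply, fourier_apply, smul_comm, AddCircle.toCircle_nsmul, Circle.coe_pow]

theorem fourier_sub (k l : ℤ) (x : UnitAddCircle) :
    fourier (k - l) x = fourier k x * (starRingEnd ℂ) (fourier l x) := by
  rw [sub_eq_add_neg, fourier_add, fourier_neg]

theorem norm_measureFourierCoeff_le (ν : Measure UnitAddCircle) [IsProbabilityMeasure ν] (k : ℤ) :
    ‖measureFourierCoeff ν k‖ ≤ 1 := by
  have := norm_integral_le_of_norm_le_const (μ := ν) (f := fun y => fourier (-k) y) (C := 1)
    (Eventually.of_forall fun y => (norm_fourier_apply _ _).le)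
  simpa [measureFourierCoeff] using this

theorem measureFourierCoeff_zero (ν : Measure UnitAddCircle) [IsProbabilityMeasure ν] :
    measureFourierCoeff ν 0 = 1 := by
  simp [measureFourierCoeff]

/-- The Fourier coefficients of an absolutely continuous measure vanish at infinity. -/
theorem tendsto_measureFourierCoeff_cofinite (ν : Measure UnitAddCircle) [IsProbabilityMeasure ν]
    (hac : ν ≪ volume) : Tendsto (measureFourierCoeff ν) cofinite (𝓝 0) := by
  set g : UnitAddCircle → ℝ := fun y => (ν.rnDeriv volume y).toReal
  set f : ℝ → ℂ := (Set.Ioc (0 : ℝ) (0 + 1)).indicator fun t => (g (t : UnitAddCircle) : ℂ)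
  have hf : ∀ k : ℤ, measureFourierCoeff ν k =
      ∫ v : ℝ, Real.fourierChar (-(v * (k : ℝ))) • f v := by
    intro k
    have h1 : measureFourierCoeff ν k = ∫ y, g y • fourier (-k) y := by
      rw [measureFourierCoeff, ← integral_rnDeriv_smul hac]
    rw [h1, ← UnitAddCircle.integral_preimage 0, ← integral_indicator measurableSet_Ioc]
    congr 1
    ext v
    by_cases hv : v ∈ Set.Ioc (0 : ℝ) (0 + 1)
    · simp only [f, Set.indicator_of_mem hv]
      rw [fourier_coe_apply, Circle.smul_def, Real.fourierChar_apply, Complex.real_smul,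
        smul_eq_mul, mul_comm]
      congr 2
      push_cast
      ring
    · simp only [f, Set.indicator_of_notMem hv, smul_zero]
  have h := (Real.tendsto_integral_exp_smul_cocompact f).comp Int.tendsto_coe_cofinite
  refine h.congr fun k => ?_
  rw [hf k]
  rfl

/-- The Fejér mean of order `d` of `ν`, evaluated at `n • x` and divided by its
maximal possible value `d`. -/
noncomputable def fejerWeight (ν : Measure UnitAddCircle) (x : UnitAddCircle) (d n : ℕ) : ℝ :=
  ((d : ℝ) ^ 2)⁻¹ * ∫ y, ‖∑ j ∈ Finset.range d, fourier (j : ℤ) (n • x - y)‖ ^ 2 ∂ν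

theorem fejerWeight_nonneg (ν : Measure UnitAddCircle) (x : UnitAddCircle) (d n : ℕ) :
    0 ≤ fejerWeight ν x d n :=
  mul_nonneg (by positivity) (integral_nonneg fun _ => by positivity)

theorem fejerWeight_le_one (ν : Measure UnitAddCircle) [IsProbabilityMeasure ν]
    (x : UnitAddCircle) (d n : ℕ) : fejerWeight ν x d n ≤ 1 := by
  have h : ∫ y, ‖∑ j ∈ Finset.range d, fourier (j : ℤ) (n • x - y)‖ ^ 2 ∂ν ≤ (d : ℝ) ^ 2 := by
    have := norm_integral_le_of_norm_le_const (μ := ν) (C := (d : ℝ) ^ 2)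
      (f := fun y => ‖∑ j ∈ Finset.range d, fourier (j : ℤ) (n • x - y)‖ ^ 2)
      (Eventually.of_forall fun y => by
        rw [norm_pow, norm_norm]
        gcongr
        refine (norm_sum_le _ _).trans_eq ?_
        simp [norm_fourier_apply, -fourier_apply])
    refine (Real.le_norm_self _).trans (this.trans_eq (by simp))
  rw [fejerWeight, inv_mul_eq_div]
  exact div_le_one_of_le₀ h (by positivity)

theorem ofReal_fejerWeight (ν : Measure UnitAddCircle) [IsProbabilityMeasure ν]
    (x : UnitAddCircle) (d n : ℕ) : (fejerWeight ν x d n : ℂ) = ((d : ℂ) ^ 2)⁻¹ *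
      ∑ i ∈ Finset.range d, ∑ j ∈ Finset.range d,
        measureFourierCoeff ν ((i : ℤ) - j) * fourier ((i : ℤ) - j) x ^ n := by
  have hpt : ∀ y : UnitAddCircle,
      ((‖∑ j ∈ Finset.range d, fourier (j : ℤ) (n • x - y)‖ ^ 2 : ℝ) : ℂ) =
      ∑ i ∈ Finset.range d, ∑ j ∈ Finset.range d,
        fourier (-((i : ℤ) - j)) y * fourier ((i : ℤ) - j) x ^ n := by
    intro y
    rw [Complex.ofReal_pow, ← Complex.mul_conj', map_sum, Finset.sum_mul_sum]
    refine Finset.sum_congr rfl fun i _ => Finset.sum_congr rfl fun j _ => ?_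
    rw [← fourier_sub, ← fourier_nsmul, fourier_apply, fourier_apply, fourier_apply, smul_sub,
      sub_eq_add_neg, AddCircle.toCircle_add, Circle.coe_mul, neg_smul, mul_comm]
  have hint : ∀ (k : ℤ) (c : ℂ), Integrable (fun y : UnitAddCircle => fourier k y * c) ν :=
    fun k c => ((map_continuous (fourier k)).integrable_of_hasCompactSupport
      (HasCompactSupport.of_compactSpace _)).mul_const c
  rw [fejerWeight, Complex.ofReal_mul, ← integral_complex_ofReal]
  simp_rw [hpt]
  push_cast
  rw [integral_finsetSum _ fun i _ => integrable_finsetSum _ fun j _ => hint _ _]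
  congr 1
  refine Finset.sum_congr rfl fun i _ => ?_
  rw [integral_finsetSum _ fun j _ => hint _ _]
  refine Finset.sum_congr rfl fun j _ => ?_
  rw [integral_mul_const, measureFourierCoeff]

/-- The number of pairs in `{0, …, d - 1}` with difference `p`. -/
def diffCount (d : ℕ) (p : ℤ) : ℝ :=
  ∑ i ∈ Finset.range d, ∑ j ∈ Finset.range d, if (i : ℤ) - j = p then 1 else 0

theorem diffCount_nonneg (d : ℕ) (p : ℤ) : 0 ≤ diffCount d p :=
  Finset.sum_nonneg fun _ _ => Finset.sum_nonneg fun _ _ => by split_ifs <;> norm_num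

theorem diffCount_le (d : ℕ) (p : ℤ) : diffCount d p ≤ d := by
  calc diffCount d p ≤ ∑ i ∈ Finset.range d, (1 : ℝ) := by
        refine Finset.sum_le_sum fun i _ => ?_
        rw [Finset.sum_boole]
        have : ((Finset.range d).filter fun j : ℕ => (i : ℤ) - j = p).card ≤ 1 :=
          Finset.card_le_one.2 fun a ha b hb => by
            simp only [Finset.mem_filter] at ha hb
            omega
        exact_mod_cast this
    _ = d := by simp

theorem sub_abs_le_diffCount (d : ℕ) (p : ℤ) : (d : ℝ) - |(p : ℝ)| ≤ diffCount d p := by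
  have h1 : ((d - p.natAbs : ℕ) : ℝ) ≤ diffCount d p := by
    rw [diffCount, ← Finset.sum_product', Finset.sum_boole]
    have := Finset.card_le_card_of_injOn (s := Finset.range (d - p.natAbs))
      (t := (Finset.range d ×ˢ Finset.range d).filter fun q : ℕ × ℕ => (q.1 : ℤ) - q.2 = p)
      (fun t => (t + p.toNat, t + (-p).toNat))
      (fun t ht => by
        simp only [Finset.coe_range, Set.mem_Iio] at ht
        simp only [Finset.coe_filter, Finset.mem_product, Finset.mem_range, Set.mem_ofPred_eq]
        omega)
      (fun a _ b _ hab => by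
        simp only [Prod.mk.injEq] at hab
        omega)
    rw [Finset.card_range] at this
    exact_mod_cast this
  have h2 : (d : ℝ) ≤ ((d - p.natAbs : ℕ) : ℝ) + |(p : ℝ)| := by
    have : d ≤ (d - p.natAbs) + p.natAbs := by omega
    have h3 : ((p.natAbs : ℕ) : ℝ) = |(p : ℝ)| := by
      rw [Nat.cast_natAbs, Int.cast_abs]
    rw [← h3]
    exact_mod_cast this
  linarith

theorem norm_sum_sub_diffCount_mul_le (g : ℤ → ℂ) (p : ℤ) (d : ℕ) {B : ℝ} (hB : 0 ≤ B)
    (hg : ∀ k : ℤ, |k| < d → k ≠ p → ‖g k‖ ≤ B) :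
    ‖∑ i ∈ Finset.range d, ∑ j ∈ Finset.range d, g ((i : ℤ) - j) - (diffCount d p : ℂ) * g p‖ ≤
      (d : ℝ) ^ 2 * B := by
  have h : (diffCount d p : ℂ) * g p = ∑ i ∈ Finset.range d, ∑ j ∈ Finset.range d,
      if (i : ℤ) - j = p then g p else 0 := by
    rw [diffCount]
    push_cast
    rw [Finset.sum_mul]
    refine Finset.sum_congr rfl fun i _ => ?_
    rw [Finset.sum_mul]
    refine Finset.sum_congr rfl fun j _ => ?_
    split_ifs <;> simp
  rw [h, ← Finset.sum_sub_distrib]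
  simp_rw [← Finset.sum_sub_distrib]
  calc _ ≤ ∑ i ∈ Finset.range d, ∑ j ∈ Finset.range d, B := by
        refine (norm_sum_le _ _).trans (Finset.sum_le_sum fun i hi => ?_)
        refine (norm_sum_le _ _).trans (Finset.sum_le_sum fun j hj => ?_)
        rw [Finset.mem_range] at hi hj
        split_ifs with hp
        · rw [hp, sub_self, norm_zero]; exact hB
        · rw [sub_zero]
          exact hg _ (by rw [abs_lt]; omega) hp
    _ = _ := by simp; ring

theorem norm_sum_Ico_pow_le {z : ℂ} (hz : ‖z‖ = 1) (h1 : z ≠ 1) {a b : ℕ} (hab : a ≤ b) :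
    ‖∑ n ∈ Finset.Ico a b, z ^ n‖ ≤ 2 / ‖z - 1‖ := by
  rw [geom_sum_Ico h1 hab, norm_div]
  gcongr
  refine (norm_sub_le _ _).trans_eq ?_
  rw [norm_pow, norm_pow, hz]
  norm_num

theorem exists_separation (v : ℤ → ℂ) (hv : ∀ k, k ≠ 0 → v k ≠ 1) :
    ∃ κ : ℕ → ℝ, Tendsto κ atTop (𝓝 0) ∧ (∀ d, 0 < κ d) ∧
      ∀ (d : ℕ) (k : ℤ), k ≠ 0 → |k| < 2 * d → κ d ≤ ‖v k - 1‖ := by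
  have key : ∀ d : ℕ, ∃ r : ℝ, 0 < r ∧ r ≤ 1 / ((d : ℝ) + 1) ∧
      ∀ k : ℤ, k ≠ 0 → |k| < 2 * d → r ≤ ‖v k - 1‖ := by
    intro d
    have hfin : (insert (0 : ℤ) (Finset.Ioo (-(2 * d : ℤ)) (2 * d))).Nonempty :=
      Finset.insert_nonempty _ _
    obtain ⟨k₀, -, hk₀⟩ := Finset.exists_min_image _
      (fun k : ℤ => if k = 0 then 1 / ((d : ℝ) + 1) else ‖v k - 1‖) hfin
    have hpos : ∀ k : ℤ, 0 < if k = 0 then 1 / ((d : ℝ) + 1) else ‖v k - 1‖ := by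
      intro k
      split_ifs with hk
      · positivity
      · exact norm_pos_iff.2 (sub_ne_zero.2 (hv k hk))
    refine ⟨_, hpos k₀, ?_, fun k hk hkd => ?_⟩
    · simpa using hk₀ 0 (Finset.mem_insert_self _ _)
    · have := hk₀ k (Finset.mem_insert_of_mem (Finset.mem_Ioo.2 (abs_lt.1 hkd)))
      simpa only [if_neg hk] using this
  choose κ h1 h2 h3 using key
  exact ⟨κ, squeeze_zero (fun d => (h1 d).le) h2 tendsto_one_div_add_atTop_nhds_zero_nat, h1, h3⟩

/-- Sums of a Fejér weight against a character over an interval reduce to the contribution of a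
single frequency `p`, provided all other frequencies below `d` are far from resonance. -/
theorem norm_sum_fejerWeight_sub_le (ν : Measure UnitAddCircle) [IsProbabilityMeasure ν]
    (x : UnitAddCircle) {b : ℂ} (hb : ‖b‖ = 1) {d : ℕ} (hd : 1 ≤ d) (p : ℤ) {κ : ℝ} (hκ : 0 < κ)
    (hp : ∀ k : ℤ, |k| < d → k ≠ p → κ ≤ ‖fourier k x * b - 1‖) {s t : ℕ} (hst : s ≤ t) :
    ‖∑ n ∈ Finset.Ico s t, (fejerWeight ν x d n : ℂ) * b ^ n - ((d : ℂ) ^ 2)⁻¹ *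
      (diffCount d p * (measureFourierCoeff ν p *
        ∑ n ∈ Finset.Ico s t, (fourier p x * b) ^ n))‖ ≤ 2 / κ := by
  have h1 : ∑ n ∈ Finset.Ico s t, (fejerWeight ν x d n : ℂ) * b ^ n =
      ((d : ℂ) ^ 2)⁻¹ * ∑ i ∈ Finset.range d, ∑ j ∈ Finset.range d,
        (fun k : ℤ => measureFourierCoeff ν k * ∑ n ∈ Finset.Ico s t, (fourier k x * b) ^ n)
          ((i : ℤ) - j) := by
    simp_rw [ofReal_fejerWeight, mul_assoc]
    rw [← Finset.mul_sum]
    congr 1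
    simp_rw [Finset.sum_mul, Finset.mul_sum]
    rw [Finset.sum_comm]
    refine Finset.sum_congr rfl fun i _ => ?_
    rw [Finset.sum_comm]
    refine Finset.sum_congr rfl fun j _ => Finset.sum_congr rfl fun n _ => ?_
    rw [mul_pow]; ring
  have h2 := norm_sum_sub_diffCount_mul_le
    (fun k : ℤ => measureFourierCoeff ν k * ∑ n ∈ Finset.Ico s t, (fourier k x * b) ^ n) p d
    (B := 2 / κ) (by positivity) (fun k hk hkp => by
      have hk1 := hp k hk hkp
      have hne : fourier k x * b ≠ 1 := fun h => by
        rw [h, sub_self, norm_zero] at hk1; linarith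
      rw [norm_mul]
      calc _ ≤ 1 * (2 / ‖fourier k x * b - 1‖) := by
            gcongr
            · exact norm_measureFourierCoeff_le ν k
            · exact norm_sum_Ico_pow_le (by rw [norm_mul, norm_fourier_apply, hb, one_mul]) hne hst
        _ ≤ 2 / κ := by rw [one_mul]; gcongr)
  rw [h1, ← mul_sub, norm_mul, norm_inv, norm_pow, Complex.norm_natCast]
  have hd' : (0 : ℝ) < (d : ℝ) ^ 2 := by positivity
  rw [inv_mul_le_iff₀ hd']
  exact h2

/-- At frequencies separated by at least `κ`, at most one can be within `κ / 2` of resonance. -/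
theorem eq_of_near_resonance {x : UnitAddCircle} {b : ℂ} (hb : ‖b‖ = 1) {κ : ℝ} {d : ℕ}
    (hκ : ∀ k : ℤ, k ≠ 0 → |k| < 2 * d → κ ≤ ‖fourier k x - 1‖) {k l : ℤ} (hk : |k| < d)
    (hl : |l| < d) (hk' : ‖fourier k x * b - 1‖ < κ / 2) (hl' : ‖fourier l x * b - 1‖ < κ / 2) :
    k = l := by
  by_contra hne
  have h1 := hκ (k - l) (sub_ne_zero.2 hne) (by rw [abs_lt] at *; omega)
  have h2 : ‖fourier (k - l) x - 1‖ = ‖fourier k x * b - fourier l x * b‖ := by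
    have : fourier k x = fourier (k - l) x * fourier l x := by rw [← fourier_add, sub_add_cancel]
    rw [← sub_mul, norm_mul, hb, mul_one, this, ← sub_one_mul, norm_mul, norm_fourier_apply,
      mul_one]
  have h3 : ‖fourier k x * b - fourier l x * b‖ < κ := by
    calc _ = ‖(fourier k x * b - 1) - (fourier l x * b - 1)‖ := by congr 1; ring
      _ ≤ _ := norm_sub_le _ _
      _ < κ := by linarith
  linarith

/-- Quantitative mean values of the Fejér weights against a character `n ↦ b ^ n`: the error
constant `K d` is uniform in `b`. -/
theorem exists_uniform_mean_estimate (ν : Measure UnitAddCircle) [IsProbabilityMeasure ν]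
    (hc : Tendsto (measureFourierCoeff ν) cofinite (𝓝 0)) (x : UnitAddCircle)
    (hx : ∀ k : ℤ, k ≠ 0 → fourier k x ≠ 1) :
    ∃ K : ℕ → ℝ, (∀ d, 0 ≤ K d) ∧ ∀ b L : ℂ, ‖b‖ = 1 →
      ((∃ p, fourier p x * b = 1 ∧ L = measureFourierCoeff ν p) ∨
        ((∀ p, fourier p x * b ≠ 1) ∧ L = 0)) →
      ∃ η : ℕ → ℝ, Tendsto η atTop (𝓝 0) ∧ ∀ d, 1 ≤ d → ∀ s t, s ≤ t →
        ‖∑ n ∈ Finset.Ico s t, ((fejerWeight ν x d n : ℂ) * b ^ n - L / d)‖ ≤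
          ((t : ℝ) - s) * (η d / d) + K d := by
  obtain ⟨κ, hκ0, hκpos, hκ⟩ := exists_separation (fun k => fourier k x) hx
  refine ⟨fun d => 4 / κ d, fun d => by have := hκpos d; positivity, fun b L hb hL => ?_⟩
  have h24 : ∀ d, 2 / (κ d / 2) = 4 / κ d := fun d => by rw [div_div_eq_mul_div]; norm_num
  rcases hL with ⟨p, hpb, rfl⟩ | ⟨hpb, rfl⟩
  · refine ⟨fun d => if (d : ℤ) ≤ |p| then 2 * d else |(p : ℝ)| / d, ?_, fun d hd s t hst => ?_⟩
    · refine (tendsto_const_div_atTop_nhds_zero_nat |(p : ℝ)|).congr' ?_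
      filter_upwards [eventually_gt_atTop p.natAbs] with d hd
      rw [if_neg]
      rw [not_le, Int.abs_eq_natAbs]
      omega
    have hd0 : (0 : ℝ) < d := by exact_mod_cast hd
    have hst' : (0 : ℝ) ≤ (t : ℝ) - s := sub_nonneg.2 (by exact_mod_cast hst)
    have hK : 0 ≤ 4 / κ d := by have := hκpos d; positivity
    have hcp := norm_measureFourierCoeff_le ν p
    beta_reduce
    split_ifs with hdp
    · have : ‖∑ n ∈ Finset.Ico s t,
          ((fejerWeight ν x d n : ℂ) * b ^ n - measureFourierCoeff ν p / d)‖ ≤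
          ∑ n ∈ Finset.Ico s t, (2 : ℝ) := by
        refine (norm_sum_le _ _).trans (Finset.sum_le_sum fun n _ => ?_)
        refine (norm_sub_le _ _).trans ?_
        rw [norm_mul, norm_pow, hb, one_pow, mul_one, Complex.norm_real, Real.norm_eq_abs,
          abs_of_nonneg (fejerWeight_nonneg _ _ _ _), norm_div, Complex.norm_natCast]
        have h1 := fejerWeight_le_one ν x d n
        have h2 : ‖measureFourierCoeff ν p‖ / d ≤ 1 :=
          div_le_one_of_le₀ (hcp.trans (by exact_mod_cast hd)) hd0.le
        linarith
      rw [Finset.sum_const, Nat.card_Ico, nsmul_eq_mul, Nat.cast_sub hst] at this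
      rw [mul_div_cancel_right₀ _ hd0.ne']
      linarith
    · have h1 := norm_sum_fejerWeight_sub_le ν x hb hd p (half_pos (hκpos d))
        (fun k hk hkp => by
          have hp' := abs_lt.1 (not_le.1 hdp)
          have hk' := abs_lt.1 hk
          have := hκ d (k - p) (sub_ne_zero.2 hkp) (by rw [abs_lt]; omega)
          have h2 : fourier k x * b = fourier (k - p) x := by
            have : fourier k x = fourier (k - p) x * fourier p x := by
              rw [← fourier_add, sub_add_cancel]
            rw [this, mul_assoc, hpb, mul_one]
          rw [h2]
          have := hκpos d
          linarith) hst
      simp_rw [hpb, one_pow] at h1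
      rw [Finset.sum_const, Nat.card_Ico, nsmul_eq_mul, mul_one, Nat.cast_sub hst, h24] at h1
      rw [Finset.sum_sub_distrib, Finset.sum_const, Nat.card_Ico, nsmul_eq_mul, Nat.cast_sub hst]
      have h3 : ‖((d : ℂ) ^ 2)⁻¹ * (diffCount d p * (measureFourierCoeff ν p * ((t : ℂ) - s))) -
          ((t : ℂ) - s) * (measureFourierCoeff ν p / d)‖ ≤ ((t : ℝ) - s) * (|(p : ℝ)| / d / d) := by
        have hdc : (d : ℂ) ≠ 0 := by exact_mod_cast hd0.ne'
        have e1 : ((d : ℂ) ^ 2)⁻¹ * (diffCount d p * (measureFourierCoeff ν p * ((t : ℂ) - s))) -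
          ((t : ℂ) - s) * (measureFourierCoeff ν p / d) =
          ((((t : ℝ) - s) * ((diffCount d p - d) / d / d) : ℝ) : ℂ) * measureFourierCoeff ν p := by
          push_cast
          field_simp
        rw [e1, norm_mul, Complex.norm_real, Real.norm_eq_abs, abs_mul, abs_of_nonneg hst', abs_div,
          abs_div, abs_of_pos hd0]
        have e2 : |diffCount d p - d| ≤ |(p : ℝ)| := by
          have a1 := diffCount_le d p
          have a2 := sub_abs_le_diffCount d p
          rw [abs_le]
          constructor <;> linarith [abs_nonneg (p : ℝ)]
        calc _ ≤ ((t : ℝ) - s) * (|(p : ℝ)| / d / d) * 1 := by gcongr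
          _ = _ := mul_one _
      exact (norm_sub_le_norm_sub_add_norm_sub _ _ _).trans (by linarith)
  · have hq : ∀ d : ℕ, ∃ p : ℤ, (p = d ∨ ‖fourier p x * b - 1‖ < κ d / 2) ∧
        ∀ k : ℤ, |k| < d → k ≠ p → κ d / 2 ≤ ‖fourier k x * b - 1‖ := by
      intro d
      by_cases h : ∃ p : ℤ, |p| < d ∧ ‖fourier p x * b - 1‖ < κ d / 2
      · obtain ⟨p, hpd, hp⟩ := h
        refine ⟨p, Or.inr hp, fun k hk hkp => ?_⟩
        by_contra! hlt
        exact hkp (eq_of_near_resonance hb (hκ d) hk hpd hlt hp)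
      · push Not at h
        exact ⟨d, Or.inl rfl, fun k hk _ => h k hk⟩
    choose q hq1 hq2 using hq
    refine ⟨fun d => ‖measureFourierCoeff ν (q d)‖, ?_, fun d hd s t hst => ?_⟩
    · have hqt : Tendsto q atTop cofinite := by
        rw [Tendsto, le_cofinite_iff_eventually_ne]
        intro k
        rw [eventually_map]
        have hpos : 0 < ‖fourier k x * b - 1‖ := norm_pos_iff.2 (sub_ne_zero.2 (hpb k))
        filter_upwards [hκ0.eventually (gt_mem_nhds hpos), eventually_gt_atTop k.natAbs]
          with d h1 h2 hqk
        rcases hq1 d with h | h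
        · omega
        · rw [hqk] at h
          linarith [hκpos d]
      simpa using (hc.comp hqt).norm
    have hd0 : (0 : ℝ) < d := by exact_mod_cast hd
    have hst' : (0 : ℝ) ≤ (t : ℝ) - s := sub_nonneg.2 (by exact_mod_cast hst)
    have h1 := norm_sum_fejerWeight_sub_le ν x hb hd (q d) (half_pos (hκpos d)) (hq2 d) hst
    rw [h24] at h1
    simp only [zero_div, sub_zero]
    have h2 : ‖((d : ℂ) ^ 2)⁻¹ * (diffCount d (q d) * (measureFourierCoeff ν (q d) *
        ∑ n ∈ Finset.Ico s t, (fourier (q d) x * b) ^ n))‖ ≤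
        ((t : ℝ) - s) * (‖measureFourierCoeff ν (q d)‖ / d) := by
      have e1 : ‖∑ n ∈ Finset.Ico s t, (fourier (q d) x * b) ^ n‖ ≤ (t : ℝ) - s := by
        refine (norm_sum_le _ _).trans_eq ?_
        simp only [norm_pow, norm_mul, norm_fourier_apply, hb, mul_one, one_pow, Finset.sum_const,
          Nat.card_Ico, nsmul_eq_mul, Nat.cast_sub hst]
      rw [norm_mul, norm_mul, norm_mul, norm_inv, norm_pow, Complex.norm_natCast, Complex.norm_real,
        Real.norm_eq_abs, abs_of_nonneg (diffCount_nonneg _ _)]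
      calc _ ≤ ((d : ℝ) ^ 2)⁻¹ * (d * (‖measureFourierCoeff ν (q d)‖ * ((t : ℝ) - s))) := by
            gcongr
            exact diffCount_le _ _
        _ = _ := by field_simp
    calc _ ≤ _ := norm_le_norm_sub_add _ (((d : ℂ) ^ 2)⁻¹ * (diffCount d (q d) *
          (measureFourierCoeff ν (q d) * ∑ n ∈ Finset.Ico s t, (fourier (q d) x * b) ^ n)))
      _ ≤ _ := by linarith

/-- There is a nondecreasing unbounded sequence of orders growing slowly compared to given
costs `K`. -/
theorem exists_slow_sequence (K : ℕ → ℝ) (hK : ∀ d, 0 ≤ K d) :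
    ∃ D : ℕ → ℕ, Monotone D ∧ Tendsto D atTop atTop ∧ (∀ n, 1 ≤ D n) ∧ ∃ C : ℝ, 0 ≤ C ∧
      ∀ n, D n + ∑ i ∈ Finset.range (D n + 1), K i ≤ C + (n : ℝ) ^ (1 / 8 : ℝ) := by
  classical
  set B : ℕ → ℝ := fun k => ((k + 1 : ℕ) : ℝ) + ∑ i ∈ Finset.range (k + 1 + 1), K i with hB
  have hB0 : ∀ k, 0 ≤ B k := fun k => add_nonneg (by positivity) (Finset.sum_nonneg fun i _ => hK i)
  set P : ℕ → ℕ → Prop := fun n k => B k ≤ (n : ℝ) ^ (1 / 8 : ℝ) with hP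
  have hPmono : ∀ {m n k}, m ≤ n → P m k → P n k := fun {m n k} hmn h =>
    le_trans h (Real.rpow_le_rpow (by positivity) (by exact_mod_cast hmn) (by norm_num))
  refine ⟨fun n => Nat.findGreatest (P n) n + 1, fun m n hmn => ?_, ?_, fun n => Nat.succ_le_succ (Nat.zero_le _),
    B 0, hB0 0, fun n => ?_⟩
  · exact Nat.succ_le_succ (Nat.findGreatest_mono (fun k => hPmono hmn) hmn)
  · refine tendsto_atTop.2 fun k => ?_
    have h1 : Tendsto (fun n : ℕ => (n : ℝ) ^ (1 / 8 : ℝ)) atTop atTop :=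
      (tendsto_rpow_atTop (by norm_num)).comp tendsto_natCast_atTop_atTop
    filter_upwards [h1.eventually_ge_atTop (B k), eventually_ge_atTop k] with n hn hkn
    exact (Nat.le_findGreatest (P := P n) hkn hn).trans (Nat.le_succ _)
  · change B (Nat.findGreatest (P n) n) ≤ _
    have hn0 : (0 : ℝ) ≤ (n : ℝ) ^ (1 / 8 : ℝ) := by positivity
    rcases Nat.eq_zero_or_pos (Nat.findGreatest (P n) n) with h | h
    · rw [h]; linarith
    · have : P n (Nat.findGreatest (P n) n) := Nat.findGreatest_of_ne_zero rfl h.ne'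
      have h2 := hB0 0
      simp only [hP] at this
      linarith

theorem natCast_le_mul_sum_inv {D : ℕ → ℕ} (hD : Monotone D) (h1 : ∀ n, 1 ≤ D n) (N : ℕ) :
    (N : ℝ) ≤ D N * ∑ n ∈ Finset.range N, (1 : ℝ) / D n := by
  rw [Finset.mul_sum]
  calc (N : ℝ) = ∑ n ∈ Finset.range N, (1 : ℝ) := by simp
    _ ≤ _ := Finset.sum_le_sum fun n hn => by
      have h2 : (0 : ℝ) < D n := by exact_mod_cast h1 n
      rw [mul_one_div, one_le_div h2]
      exact_mod_cast hD (Finset.mem_range.1 hn).le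

/-- A set of indices below `N` on which a monotone function takes a given value is an interval. -/
theorem exists_filter_range_eq_Ico {D : ℕ → ℕ} (hD : Monotone D) (N i : ℕ) :
    ∃ s t, s ≤ t ∧ (Finset.range N).filter (fun n => D n = i) = Finset.Ico s t := by
  rcases ((Finset.range N).filter (fun n => D n = i)).eq_empty_or_nonempty with h | h
  · exact ⟨0, 0, le_rfl, by simp [h]⟩
  · have hmin := Finset.min'_mem _ h
    have hmax := Finset.max'_mem _ h
    refine ⟨Finset.min' _ h, Finset.max' _ h + 1,
      (Finset.min'_le_max' _ h).trans (Nat.le_succ _), ?_⟩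
    ext n
    rw [Finset.mem_Ico]
    refine ⟨fun hn => ⟨Finset.min'_le _ _ hn, Nat.lt_succ_of_le (Finset.le_max' _ _ hn)⟩,
      fun hn => ?_⟩
    have hn2 := Nat.le_of_lt_succ hn.2
    simp only [Finset.mem_filter, Finset.mem_range] at hmin hmax ⊢
    refine ⟨hn2.trans_lt hmax.1, le_antisymm ((hD hn2).trans_eq hmax.2) ?_⟩
    exact hmin.2.symm.trans_le (hD hn.1)

theorem norm_sum_diagonal_le {D : ℕ → ℕ} (hD : Monotone D) (h1 : ∀ n, 1 ≤ D n) {K η : ℕ → ℝ}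
    (hK : ∀ d, 0 ≤ K d) {U : ℕ → ℕ → ℂ}
    (hU : ∀ d, 1 ≤ d → ∀ s t, s ≤ t →
      ‖∑ n ∈ Finset.Ico s t, U d n‖ ≤ ((t : ℝ) - s) * (η d / d) + K d) (N : ℕ) :
    ‖∑ n ∈ Finset.range N, U (D n) n‖ ≤
      ∑ n ∈ Finset.range N, η (D n) / D n + ∑ i ∈ Finset.range (D N + 1), K i := by
  have hmaps : ∀ n ∈ Finset.range N, D n ∈ Finset.range (D N + 1) := fun n hn =>
    Finset.mem_range.2 (Nat.lt_succ_of_le (hD (Finset.mem_range.1 hn).le))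
  rw [← Finset.sum_fiberwise_of_maps_to hmaps (fun n => U (D n) n),
    ← Finset.sum_fiberwise_of_maps_to hmaps (fun n => η (D n) / D n), ← Finset.sum_add_distrib]
  refine (norm_sum_le _ _).trans (Finset.sum_le_sum fun i _ => ?_)
  rcases Nat.eq_zero_or_pos i with rfl | hi
  · have : (Finset.range N).filter (fun n => D n = 0) = ∅ := by
      rw [Finset.filter_eq_empty_iff]
      intro n _ h
      have := h1 n
      omega
    simpa [this] using hK 0
  · obtain ⟨s, t, hst, hI⟩ := exists_filter_range_eq_Ico hD N i
    have e1 : ∑ n ∈ (Finset.range N).filter (fun n => D n = i), U (D n) n =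
        ∑ n ∈ Finset.Ico s t, U i n := by
      rw [← hI]
      refine Finset.sum_congr rfl fun n hn => ?_
      rw [(Finset.mem_filter.1 hn).2]
    have e2 : ∑ n ∈ (Finset.range N).filter (fun n => D n = i), η (D n) / D n =
        ((t : ℝ) - s) * (η i / i) := by
      have : ∑ n ∈ (Finset.range N).filter (fun n => D n = i), η (D n) / D n =
          ∑ n ∈ Finset.Ico s t, η i / i := by
        rw [← hI]
        refine Finset.sum_congr rfl fun n hn => ?_
        rw [(Finset.mem_filter.1 hn).2]
      rw [this, Finset.sum_const, Nat.card_Ico, nsmul_eq_mul, Nat.cast_sub hst]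
    rw [e1, e2]
    exact hU i hi s t hst

theorem tendsto_add_rpow_mul_rpow (C : ℝ) {a : ℝ} (ha : a < 7 / 8) :
    Tendsto (fun N : ℕ => (N : ℝ) ^ a * (C + (N : ℝ) ^ (1 / 8 : ℝ)) / N) atTop (𝓝 0) := by
  have h1 : ∀ r : ℝ, r < 0 → Tendsto (fun N : ℕ => (N : ℝ) ^ r) atTop (𝓝 0) := fun r hr => by
    have := (tendsto_rpow_neg_atTop (y := -r) (by linarith)).comp
      (tendsto_natCast_atTop_atTop (R := ℝ))
    simpa [Function.comp_def] using this
  have h2 := ((h1 (a - 1) (by linarith)).const_mul C).add (h1 (a + 1 / 8 - 1) (by linarith))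
  rw [mul_zero, add_zero] at h2
  refine h2.congr' ?_
  filter_upwards [eventually_gt_atTop 0] with N hN
  have hN' : (0 : ℝ) < N := by exact_mod_cast hN
  rw [Real.rpow_sub hN', Real.rpow_sub hN', Real.rpow_add hN', Real.rpow_one]
  ring

/-- The normalizing sums `∑ 1 / D n` dominate `N ^ (3/4)` and the accumulated costs. -/
theorem tendsto_div_sum_inv {D : ℕ → ℕ} (hD : Monotone D) (h1 : ∀ n, 1 ≤ D n) {C : ℝ}
    (hC : 0 ≤ C) {K : ℕ → ℝ} (hK : ∀ d, 0 ≤ K d)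
    (hDC : ∀ n, D n + ∑ i ∈ Finset.range (D n + 1), K i ≤ C + (n : ℝ) ^ (1 / 8 : ℝ)) :
    Tendsto (fun N : ℕ => (N : ℝ) ^ (3 / 4 : ℝ) / ∑ n ∈ Finset.range N, (1 : ℝ) / D n)
        atTop (𝓝 0) ∧
      Tendsto (fun N : ℕ => (∑ i ∈ Finset.range (D N + 1), K i) /
        ∑ n ∈ Finset.range N, (1 : ℝ) / D n) atTop (𝓝 0) := by
  have hDle : ∀ n, (D n : ℝ) ≤ C + (n : ℝ) ^ (1 / 8 : ℝ) := fun n => by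
    have := hDC n
    have h2 : 0 ≤ ∑ i ∈ Finset.range (D n + 1), K i := Finset.sum_nonneg fun i _ => hK i
    linarith
  have hV0 : ∀ N, 0 ≤ ∑ n ∈ Finset.range N, (1 : ℝ) / D n := fun N =>
    Finset.sum_nonneg fun _ _ => by positivity
  have hkey : ∀ (N : ℕ) (r : ℝ), 0 ≤ r → 0 < N → r / ∑ n ∈ Finset.range N, (1 : ℝ) / D n ≤
      r * (C + (N : ℝ) ^ (1 / 8 : ℝ)) / N := by
    intro N r hr hN
    have hN' : (0 : ℝ) < N := by exact_mod_cast hN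
    have h2 : (N : ℝ) ≤ (C + (N : ℝ) ^ (1 / 8 : ℝ)) * ∑ n ∈ Finset.range N, (1 : ℝ) / D n :=
      (natCast_le_mul_sum_inv hD h1 N).trans (mul_le_mul_of_nonneg_right (hDle N) (hV0 N))
    have hV : 0 < ∑ n ∈ Finset.range N, (1 : ℝ) / D n := by
      rcases (hV0 N).lt_or_eq with h | h
      · exact h
      · rw [← h, mul_zero] at h2; linarith
    rw [div_le_div_iff₀ hV hN', mul_assoc]
    gcongr
  refine ⟨?_, ?_⟩
  · refine squeeze_zero' (Eventually.of_forall fun N => div_nonneg (by positivity) (hV0 N)) ?_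
      (tendsto_add_rpow_mul_rpow C (a := 3 / 4) (by norm_num))
    filter_upwards [eventually_gt_atTop 0] with N hN
    exact hkey N _ (by positivity) hN
  · have hlim : Tendsto (fun N : ℕ => C * ((N : ℝ) ^ (0 : ℝ) * (C + (N : ℝ) ^ (1 / 8 : ℝ)) / N) +
        (N : ℝ) ^ (1 / 8 : ℝ) * (C + (N : ℝ) ^ (1 / 8 : ℝ)) / N) atTop (𝓝 0) := by
      simpa using ((tendsto_add_rpow_mul_rpow C (a := 0) (by norm_num)).const_mul C).add
        (tendsto_add_rpow_mul_rpow C (a := 1 / 8) (by norm_num))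
    refine squeeze_zero' (Eventually.of_forall fun N =>
      div_nonneg (Finset.sum_nonneg fun i _ => hK i) (hV0 N)) ?_ hlim
    filter_upwards [eventually_gt_atTop 0] with N hN
    refine (hkey N _ (Finset.sum_nonneg fun i _ => hK i) hN).trans ?_
    have h2 : ∑ i ∈ Finset.range (D N + 1), K i ≤ C + (N : ℝ) ^ (1 / 8 : ℝ) := by
      have := hDC N
      have h3 : (0 : ℝ) ≤ D N := by positivity
      linarith
    calc _ ≤ (C + (N : ℝ) ^ (1 / 8 : ℝ)) * (C + (N : ℝ) ^ (1 / 8 : ℝ)) / N := by gcongr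
      _ = _ := by rw [Real.rpow_zero]; ring

theorem tendsto_sum_inv_atTop {D : ℕ → ℕ} (h1 : ∀ n, 1 ≤ D n)
    (h : Tendsto (fun N : ℕ => (N : ℝ) ^ (3 / 4 : ℝ) / ∑ n ∈ Finset.range N, (1 : ℝ) / D n)
      atTop (𝓝 0)) :
    Tendsto (fun N : ℕ => ∑ n ∈ Finset.range N, (1 : ℝ) / D n) atTop atTop := by
  have h2 : Tendsto (fun N : ℕ => (N : ℝ) ^ (3 / 4 : ℝ)) atTop atTop :=
    (tendsto_rpow_atTop (by norm_num)).comp tendsto_natCast_atTop_atTop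
  refine tendsto_atTop_mono' _ ?_ h2
  filter_upwards [h.eventually (gt_mem_nhds one_pos), eventually_gt_atTop 0] with N hN hN0
  have hV : 0 < ∑ n ∈ Finset.range N, (1 : ℝ) / D n :=
    Finset.sum_pos (fun n _ => by have := h1 n; positivity) (Finset.nonempty_range_iff.2 hN0.ne')
  exact ((div_lt_one hV).1 hN).le

theorem tendsto_sum_diagonal_div {D : ℕ → ℕ} (hD : Monotone D) (hDt : Tendsto D atTop atTop)
    (h1 : ∀ n, 1 ≤ D n) {K : ℕ → ℝ} (hK : ∀ d, 0 ≤ K d)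
    (hV : Tendsto (fun N : ℕ => ∑ n ∈ Finset.range N, (1 : ℝ) / D n) atTop atTop)
    (hKV : Tendsto (fun N : ℕ => (∑ i ∈ Finset.range (D N + 1), K i) /
        ∑ n ∈ Finset.range N, (1 : ℝ) / D n) atTop (𝓝 0)) {U : ℕ → ℕ → ℂ} {η : ℕ → ℝ}
    (hη : Tendsto η atTop (𝓝 0))
    (hU : ∀ d, 1 ≤ d → ∀ s t, s ≤ t →
      ‖∑ n ∈ Finset.Ico s t, U d n‖ ≤ ((t : ℝ) - s) * (η d / d) + K d) :
    Tendsto (fun N : ℕ => (∑ n ∈ Finset.range N, U (D n) n) /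
      ((∑ n ∈ Finset.range N, (1 : ℝ) / D n : ℝ) : ℂ)) atTop (𝓝 0) := by
  have ho : (fun n => η (D n) / D n) =o[atTop] fun n => (1 : ℝ) / D n := by
    refine Asymptotics.isLittleO_of_tendsto' (Eventually.of_forall fun n h => ?_) ?_
    · have : (0 : ℝ) < 1 / D n := by have := h1 n; positivity
      exact absurd h this.ne'
    · refine (hη.comp hDt).congr fun n => ?_
      have : (0 : ℝ) < D n := by exact_mod_cast h1 n
      simp only [Function.comp]
      field_simp
  have hs := (ho.sum_range (fun n => by positivity) hV).tendsto_div_nhds_zero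
  have hlim := hs.add hKV
  rw [add_zero] at hlim
  refine squeeze_zero_norm (fun N => ?_) hlim
  have hV0 : 0 ≤ ∑ n ∈ Finset.range N, (1 : ℝ) / D n :=
    Finset.sum_nonneg fun _ _ => by positivity
  rw [norm_div, Complex.norm_real, Real.norm_eq_abs, abs_of_nonneg hV0, ← add_div]
  gcongr
  exact norm_sum_diagonal_le hD h1 hK hU N

/-- For any measure whose Fourier coefficients vanish at infinity, there is a set of integers along
which all characters have mean values, given at the multiples of `x` by the Fourier coefficients
of the measure. -/
theorem exists_set_with_means (ν : Measure UnitAddCircle) [IsProbabilityMeasure ν]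
    (hc : Tendsto (measureFourierCoeff ν) cofinite (𝓝 0)) (x : UnitAddCircle)
    (hx : ∀ k : ℤ, k ≠ 0 → fourier k x ≠ 1) :
    ∃ (S : Set ℕ) (V : ℕ → ℝ), 0 ∉ S ∧ Tendsto V atTop atTop ∧ ∀ b L : ℂ, ‖b‖ = 1 →
      ((∃ p, fourier p x * b = 1 ∧ L = measureFourierCoeff ν p) ∨
        ((∀ p, fourier p x * b ≠ 1) ∧ L = 0)) →
      Tendsto (fun N : ℕ => (∑ n ∈ Finset.range N, ((S.indicator 1 n : ℝ) : ℂ) * b ^ n) / V N)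
        atTop (𝓝 L) := by
  obtain ⟨K, hK, hmean⟩ := exists_uniform_mean_estimate ν hc x hx
  obtain ⟨D, hD, hDt, h1, C, hC, hDC⟩ := exists_slow_sequence K hK
  obtain ⟨hV34, hKV⟩ := tendsto_div_sum_inv hD h1 hC hK hDC
  have hV := tendsto_sum_inv_atTop h1 hV34
  obtain ⟨S, hS0, hS⟩ := exists_set_small_discrepancy (fun n => fejerWeight ν x (D n) n)
    (fun n => fejerWeight_nonneg _ _ _ _) (fun n => fejerWeight_le_one _ _ _ _)
  refine ⟨S, fun N => ∑ n ∈ Finset.range N, (1 : ℝ) / D n, hS0, hV, fun b L hb hL => ?_⟩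
  obtain ⟨η, hη, hU⟩ := hmean b L hb hL
  have hA := tendsto_sum_diagonal_div hD hDt h1 hK hV hKV hη hU
  have hB : Tendsto (fun N : ℕ => (∑ n ∈ Finset.range N,
      ((S.indicator 1 n - fejerWeight ν x (D n) n : ℝ) : ℂ) * b ^ n) /
      ((∑ n ∈ Finset.range N, (1 : ℝ) / D n : ℝ) : ℂ)) atTop (𝓝 0) := by
    have hlim := hV34.const_mul 2
    rw [mul_zero] at hlim
    refine squeeze_zero_norm (fun N => ?_) hlim
    have hV0 : 0 ≤ ∑ n ∈ Finset.range N, (1 : ℝ) / D n :=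
      Finset.sum_nonneg fun _ _ => by positivity
    rw [norm_div, Complex.norm_real, Real.norm_eq_abs, abs_of_nonneg hV0, ← mul_div_assoc]
    gcongr
    refine le_of_pow_le_pow_left₀ (n := 4) (by norm_num) (by positivity) ((hS b hb N).trans ?_)
    have : ((N : ℝ) ^ (3 / 4 : ℝ)) ^ 4 = (N : ℝ) ^ 3 := by
      rw [← Real.rpow_natCast, ← Real.rpow_mul (by positivity), ← Real.rpow_natCast]
      norm_num
    rw [mul_pow, this]
    gcongr
    norm_num
  have hsum := (hA.add hB).add_const L
  rw [add_zero, zero_add] at hsum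
  refine hsum.congr' ?_
  filter_upwards [hV.eventually_gt_atTop 0] with N hN
  have hN' : ((∑ n ∈ Finset.range N, (1 : ℝ) / D n : ℝ) : ℂ) ≠ 0 := by exact_mod_cast hN.ne'
  rw [← add_div, ← Finset.sum_add_distrib, div_add' _ _ _ hN']
  congr 1
  have : L * ((∑ n ∈ Finset.range N, (1 : ℝ) / D n : ℝ) : ℂ) = ∑ n ∈ Finset.range N, L / D n := by
    push_cast
    rw [Finset.mul_sum]
    exact Finset.sum_congr rfl fun n _ => by ring
  rw [this, ← Finset.sum_add_distrib]
  refine Finset.sum_congr rfl fun n _ => ?_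
  push_cast
  ring

/-- The complex-valued version of `empAvg`. -/
noncomputable def empAvgC (S : Set ℕ) (y : UnitAddCircle) (N : ℕ) (g : C(UnitAddCircle, ℂ)) : ℂ :=
  ((initSeg S N).card : ℂ)⁻¹ * ∑ s ∈ initSeg S N, g (s • y)

theorem norm_empAvgC_le (S : Set ℕ) (y : UnitAddCircle) (N : ℕ) (g : C(UnitAddCircle, ℂ)) :
    ‖empAvgC S y N g‖ ≤ ‖g‖ := by
  rw [empAvgC, norm_mul, norm_inv, Complex.norm_natCast, inv_mul_eq_div]
  refine div_le_of_le_mul₀ (by positivity) (norm_nonneg _) ?_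
  refine (norm_sum_le _ _).trans ((Finset.sum_le_sum fun s _ => g.norm_coe_le_norm _).trans_eq ?_)
  rw [Finset.sum_const, nsmul_eq_mul, mul_comm]

theorem empAvgC_add (S : Set ℕ) (y : UnitAddCircle) (N : ℕ) (f g : C(UnitAddCircle, ℂ)) :
    empAvgC S y N (f + g) = empAvgC S y N f + empAvgC S y N g := by
  simp [empAvgC, Finset.sum_add_distrib, mul_add]

theorem empAvgC_smul (S : Set ℕ) (y : UnitAddCircle) (N : ℕ) (c : ℂ) (f : C(UnitAddCircle, ℂ)) :
    empAvgC S y N (c • f) = c * empAvgC S y N f := by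
  simp only [empAvgC, ContinuousMap.smul_apply, smul_eq_mul, ← Finset.mul_sum]
  ring

theorem coe_natCast_mul (s : ℕ) (β : ℝ) :
    (((s : ℝ) * β : ℝ) : UnitAddCircle) = s • (β : UnitAddCircle) := by
  rw [← nsmul_eq_mul, AddCircle.coe_nsmul]

theorem integrable_continuousMap (μ : Measure UnitAddCircle) [IsFiniteMeasure μ]
    (f : C(UnitAddCircle, ℂ)) : Integrable f μ :=
  (map_continuous f).integrable_of_hasCompactSupport (HasCompactSupport.of_compactSpace _)

theorem tendsto_empAvgC_of_fourier {S : Set ℕ} {y : UnitAddCircle} {μ : Measure UnitAddCircle}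
    [IsProbabilityMeasure μ]
    (h : ∀ k : ℤ, Tendsto (fun N => empAvgC S y N (fourier k)) atTop (𝓝 (∫ x, fourier k x ∂μ)))
    (f : C(UnitAddCircle, ℂ)) :
    Tendsto (fun N => empAvgC S y N f) atTop (𝓝 (∫ x, f x ∂μ)) := by
  have hspan : ∀ g ∈ Submodule.span ℂ (Set.range (@fourier 1)),
      Tendsto (fun N => empAvgC S y N g) atTop (𝓝 (∫ x, g x ∂μ)) := by
    intro g hg
    induction hg using Submodule.span_induction with
    | mem g hg => obtain ⟨k, rfl⟩ := hg; exact h k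
    | zero => simp [empAvgC]
    | add f g _ _ hf hg =>
      simp only [ContinuousMap.add_apply, empAvgC_add]
      rw [integral_add (integrable_continuousMap μ f) (integrable_continuousMap μ g)]
      exact hf.add hg
    | smul c f _ hf =>
      simp only [ContinuousMap.smul_apply, empAvgC_smul]
      rw [integral_smul]
      exact hf.const_mul c
  have hf : f ∈ (Submodule.span ℂ (Set.range (@fourier 1))).topologicalClosure := by
    rw [span_fourier_closure_eq_top]; trivial
  rw [← SetLike.mem_coe, Submodule.topologicalClosure_coe, Metric.mem_closure_iff] at hf
  rw [Metric.tendsto_atTop]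
  intro ε hε
  obtain ⟨g, hg, hfg⟩ := hf (ε / 3) (by positivity)
  obtain ⟨N₀, hN₀⟩ := Metric.tendsto_atTop.1 (hspan g hg) (ε / 3) (by positivity)
  refine ⟨N₀, fun N hN => ?_⟩
  rw [dist_eq_norm] at hfg
  have h1 : dist (empAvgC S y N f) (empAvgC S y N g) ≤ ‖f - g‖ := by
    have := norm_empAvgC_le S y N (f - g)
    have e : empAvgC S y N f = empAvgC S y N (f - g) + empAvgC S y N g := by
      rw [← empAvgC_add, sub_add_cancel]
    rwa [dist_eq_norm, e, add_sub_cancel_right]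
  have h2 : dist (∫ x, g x ∂μ) (∫ x, f x ∂μ) ≤ ‖f - g‖ := by
    rw [dist_comm, dist_eq_norm,
      ← integral_sub (integrable_continuousMap μ f) (integrable_continuousMap μ g)]
    have := norm_integral_le_of_norm_le_const (μ := μ) (f := fun x => f x - g x) (C := ‖f - g‖)
      (Eventually.of_forall fun x => (f - g).norm_coe_le_norm x)
    simpa using this
  calc _ ≤ _ := dist_triangle4 _ (empAvgC S y N g) (∫ x, g x ∂μ) _
    _ < ε := by linarith [hN₀ N hN]

/-- Weyl's criterion: convergence of all Fourier averages gives weak convergence. -/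
theorem isLimitMeasure_of_fourier {S : Set ℕ} {β : ℝ} {μ : Measure UnitAddCircle}
    [IsProbabilityMeasure μ] (h : ∀ k : ℤ,
      Tendsto (fun N => empAvgC S β N (fourier k)) atTop (𝓝 (∫ x, fourier k x ∂μ))) :
    IsLimitMeasure S β μ := by
  intro f
  have h1 := tendsto_empAvgC_of_fourier h
    ((⟨Complex.ofReal, Complex.continuous_ofReal⟩ : C(ℝ, ℂ)).comp f)
  simp only [ContinuousMap.comp_apply, ContinuousMap.coe_mk, integral_complex_ofReal] at h1
  have h2 := (Complex.continuous_re.tendsto _).comp h1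
  rw [Complex.ofReal_re] at h2
  refine h2.congr fun N => ?_
  simp only [Function.comp, empAvgC, empAvg, ContinuousMap.comp_apply, ContinuousMap.coe_mk,
    coe_natCast_mul]
  rw [← Complex.ofReal_sum, ← Complex.ofReal_natCast, ← Complex.ofReal_inv, ← Complex.ofReal_mul,
    Complex.ofReal_re]

/-- The empirical measure of `S(N)` along `y`. -/
noncomputable def empMeasure (S : Set ℕ) (y : UnitAddCircle) (N : ℕ) : Measure UnitAddCircle :=
  ((initSeg S N).card : ENNReal)⁻¹ • ∑ s ∈ initSeg S N, Measure.dirac (s • y)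

theorem isProbabilityMeasure_empMeasure {S : Set ℕ} (y : UnitAddCircle) {N : ℕ}
    (h : (initSeg S N).card ≠ 0) : IsProbabilityMeasure (empMeasure S y N) := by
  constructor
  simp only [empMeasure, Measure.smul_apply, Measure.finsetSum_apply, measure_univ,
    Finset.sum_const, smul_eq_mul, nsmul_eq_mul, mul_one]
  exact ENNReal.inv_mul_cancel (by exact_mod_cast h) (ENNReal.natCast_ne_top _)

theorem integral_empMeasure (S : Set ℕ) (y : UnitAddCircle) (N : ℕ) (f : C(UnitAddCircle, ℂ)) :
    ∫ x, f x ∂(empMeasure S y N) = empAvgC S y N f := by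
  rw [empMeasure, integral_smul_measure,
    integral_finsetSum_measure fun s _ => integrable_continuousMap _ f]
  simp [empAvgC, integral_dirac]

/-- If all Fourier averages converge then a weak limit exists. -/
theorem exists_isLimitMeasure {S : Set ℕ} {β : ℝ}
    (hS : Tendsto (fun N => (initSeg S N).card) atTop atTop)
    (h : ∀ k : ℤ, ∃ L : ℂ, Tendsto (fun N => empAvgC S β N (fourier k)) atTop (𝓝 L)) :
    ∃ μ : Measure UnitAddCircle, IsProbabilityMeasure μ ∧ IsLimitMeasure S β μ := by
  classical
  let P : ℕ → ProbabilityMeasure UnitAddCircle := fun N =>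
    if hN : (initSeg S N).card ≠ 0 then
      ⟨empMeasure S β N, isProbabilityMeasure_empMeasure _ hN⟩
    else ⟨Measure.dirac 0, inferInstance⟩
  let U : Ultrafilter ℕ := Ultrafilter.of atTop
  have hU : (U : Filter ℕ) ≤ atTop := Ultrafilter.of_le _
  obtain ⟨μ, -, hμ⟩ := isCompact_univ.ultrafilter_le_nhds (U.map P) (by simp)
  have hμ' : Tendsto P U (𝓝 μ) := hμ
  rw [ProbabilityMeasure.tendsto_iff_forall_integral_rclike_tendsto ℂ] at hμ'
  refine ⟨μ, inferInstance, isLimitMeasure_of_fourier fun k => ?_⟩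
  obtain ⟨L, hL⟩ := h k
  have h1 := hμ' (BoundedContinuousFunction.mkOfCompact (fourier k))
  simp only [BoundedContinuousFunction.mkOfCompact_apply] at h1
  have h2 : Tendsto (fun N => ∫ x, fourier k x ∂(P N : Measure UnitAddCircle)) U (𝓝 L) := by
    refine (hL.mono_left hU).congr' (hU ?_)
    filter_upwards [hS.eventually_ne_atTop 0] with N hN
    have hPN : P N = ⟨empMeasure S β N, isProbabilityMeasure_empMeasure _ hN⟩ := dif_pos hN
    rw [hPN]
    exact (integral_empMeasure S β N (fourier k)).symm
  rw [tendsto_nhds_unique h1 h2]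
  exact hL

theorem sum_initSeg_eq {S : Set ℕ} (hS : 0 ∉ S) (b : ℂ) (N : ℕ) :
    ∑ n ∈ Finset.range (N + 1), ((S.indicator 1 n : ℝ) : ℂ) * b ^ n =
      ∑ s ∈ initSeg S N, b ^ s := by
  classical
  rw [initSeg, Finset.sum_filter, Finset.range_eq_Ico, Finset.sum_eq_sum_Ico_succ_bot (by omega)]
  simp only [Set.indicator_of_notMem hS, Complex.ofReal_zero, zero_mul, zero_add]
  refine Finset.sum_congr (by ext; simp) fun n _ => ?_
  by_cases hn : n ∈ S <;> simp [hn]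

theorem infinite_of_tendsto_card {S : Set ℕ}
    (hS : Tendsto (fun N => (initSeg S N).card) atTop atTop) : S.Infinite := by
  classical
  intro hfin
  obtain ⟨N, hN⟩ := (hS.eventually_gt_atTop hfin.toFinset.card).exists
  refine absurd (Finset.card_le_card (s := initSeg S N) (t := hfin.toFinset) fun n hn => ?_)
    (not_le.2 hN)
  rw [initSeg, Finset.mem_filter] at hn
  exact hfin.mem_toFinset.2 hn.2

theorem fourier_coe_ne_one_of_irrational {α : ℝ} (hα : Irrational α) {k : ℤ} (hk : k ≠ 0) :
    fourier k (α : UnitAddCircle) ≠ 1 := by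
  intro h
  rw [fourier_apply] at h
  have h1 : k • (α : UnitAddCircle) = 0 := by
    refine AddCircle.injective_toCircle one_ne_zero (Subtype.ext ?_)
    rw [h, AddCircle.toCircle_zero, Circle.coe_one]
  rw [← AddCircle.coe_zsmul, AddCircle.coe_eq_zero_iff] at h1
  obtain ⟨n, hn⟩ := h1
  simp only [zsmul_eq_mul, mul_one] at hn
  exact (hα.intCast_mul hk).ne_int n hn.symm

/-- Every Borel probability measure on the torus which is absolutely continuous
with respect to the Haar-Lebesgue measure is representable at every irrational `α`. -/
theorem absolutelyContinuous_representable (ν : MeasureTheory.Measure UnitAddCircle)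
    [MeasureTheory.IsProbabilityMeasure ν]
    (hac : ν ≪ MeasureTheory.volume) (α : ℝ) (hα : Irrational α) :
    ∃ S : Set ℕ, IsGoodSet S ∧ IsLimitMeasure S α ν := by
  obtain ⟨S, V, hS0, hV, hSV⟩ := exists_set_with_means ν
    (tendsto_measureFourierCoeff_cofinite ν hac) α
    (fun k hk => fourier_coe_ne_one_of_irrational hα hk)
  have hlim : ∀ b L : ℂ, ‖b‖ = 1 →
      ((∃ p, fourier p (α : UnitAddCircle) * b = 1 ∧ L = measureFourierCoeff ν p) ∨
        ((∀ p, fourier p (α : UnitAddCircle) * b ≠ 1) ∧ L = 0)) →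
      Tendsto (fun N : ℕ => (∑ s ∈ initSeg S N, b ^ s) / V (N + 1)) atTop (𝓝 L) := by
    intro b L hb hL
    refine ((hSV b L hb hL).comp (tendsto_add_atTop_nat 1)).congr fun N => ?_
    simp only [Function.comp, sum_initSeg_eq hS0]
  have hone : Tendsto (fun N : ℕ => ((initSeg S N).card : ℂ) / V (N + 1)) atTop (𝓝 1) := by
    refine (hlim 1 1 norm_one (Or.inl ⟨0, by simp, (measureFourierCoeff_zero ν).symm⟩)).congr
      fun N => ?_
    simp
  have hV' : Tendsto (fun N => V (N + 1)) atTop atTop := hV.comp (tendsto_add_atTop_nat 1)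
  have hcard : Tendsto (fun N => (initSeg S N).card) atTop atTop := by
    rw [← tendsto_natCast_atTop_iff (R := ℝ)]
    have h1 : Tendsto (fun N : ℕ => ((initSeg S N).card : ℝ) / V (N + 1)) atTop (𝓝 1) := by
      refine ((Complex.continuous_re.tendsto _).comp hone).congr fun N => ?_
      simp only [Function.comp]
      rw [← Complex.ofReal_natCast, ← Complex.ofReal_div, Complex.ofReal_re]
    refine (h1.pos_mul_atTop one_pos hV').congr' ?_
    filter_upwards [hV'.eventually_gt_atTop 0] with N hN
    exact div_mul_cancel₀ _ hN.ne'
  have havg : ∀ b L : ℂ, ‖b‖ = 1 →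
      ((∃ p, fourier p (α : UnitAddCircle) * b = 1 ∧ L = measureFourierCoeff ν p) ∨
        ((∀ p, fourier p (α : UnitAddCircle) * b ≠ 1) ∧ L = 0)) →
      Tendsto (fun N : ℕ => ((initSeg S N).card : ℂ)⁻¹ * ∑ s ∈ initSeg S N, b ^ s)
        atTop (𝓝 L) := by
    intro b L hb hL
    have h1 := (hlim b L hb hL).div hone one_ne_zero
    rw [div_one] at h1
    refine h1.congr' ?_
    filter_upwards [hV'.eventually_gt_atTop 0] with N hN
    have hN' : (V (N + 1) : ℂ) ≠ 0 := by exact_mod_cast hN.ne'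
    simp only [Pi.div_apply]
    rw [div_div_div_cancel_right₀ hN', inv_mul_eq_div]
  have hfourier : ∀ (y : UnitAddCircle) (k : ℤ) (N : ℕ), empAvgC S y N (fourier k) =
      ((initSeg S N).card : ℂ)⁻¹ * ∑ s ∈ initSeg S N, fourier k y ^ s := fun y k N => by
    simp only [empAvgC, fourier_nsmul]
  refine ⟨S, ⟨infinite_of_tendsto_card hcard, fun β => exists_isLimitMeasure hcard fun k => ?_⟩,
    isLimitMeasure_of_fourier fun k => ?_⟩
  · simp_rw [hfourier]
    by_cases h : ∃ p, fourier p (α : UnitAddCircle) * fourier k (β : UnitAddCircle) = 1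
    · obtain ⟨p, hp⟩ := h
      exact ⟨_, havg _ _ (norm_fourier_apply _ _) (Or.inl ⟨p, hp, rfl⟩)⟩
    · push Not at h
      exact ⟨0, havg _ _ (norm_fourier_apply _ _) (Or.inr ⟨h, rfl⟩)⟩
  · simp_rw [hfourier]
    refine havg _ _ (norm_fourier_apply _ _) (Or.inl ⟨-k, ?_, ?_⟩)
    · rw [← fourier_add, neg_add_cancel, fourier_zero]
    · rw [measureFourierCoeff, neg_neg]
end
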